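/- Monotonicity of the strongly reinforced Dalang condition in the integrability parameter: Let d ≥ 1, a ∈ (0,d), and 1 ≤ r₁ ≤ r₂ < d/(d−a). Let π be a Borel measure on ℝ^d that is tempered, i.e., there exists k ≥ 0 with ∫_{ℝ^d} (1+|x|²)^{−k/2} π(dx) < ∞. If ∫_{ℝ^d} (G_a^{r₂} ∗ G_a^{r₂})(x) π(dx) < ∞, then ∫_{ℝ^d} (G_a^{r₁} ∗ G_a^{r₁})(x) π(dx) < ∞. -/

import Mathlib

open MeasureTheory Set
open scoped ENNReal

/-- The Bessel-type kernel `G_a(x) = ∫_0^∞ (4πt)^{-d/2} e^{-|x|²/(4t)} e^{-t} t^{a/2-1} dt`. -/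
noncomputable def besselKer (d : ℕ) (a : ℝ) (x : EuclideanSpace ℝ (Fin d)) : ℝ :=
  ∫ t in Ioi (0 : ℝ),
    (4 * Real.pi * t) ^ (-(d : ℝ) / 2) * Real.exp (-‖x‖ ^ 2 / (4 * t)) *
      Real.exp (-t) * t ^ (a / 2 - 1)

/-- The convolution `(G_a^r ∗ G_a^r)(x)`, valued in `[0,∞]`. -/
noncomputable def besselConv (d : ℕ) (a r : ℝ) (x : EuclideanSpace ℝ (Fin d)) : ℝ≥0∞ :=
  ∫⁻ y, ENNReal.ofReal (besselKer d a (x - y) ^ r * besselKer d a y ^ r)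

lemma rpow_le_rpow_mul_exp {u p : ℝ} (hu : 0 ≤ u) (hp : 0 < p) :
    u ^ p ≤ p ^ p * Real.exp u := by
  have h : u / p ≤ Real.exp (u / p) := by linarith [Real.add_one_le_exp (u / p)]
  have h2 := Real.rpow_le_rpow (by positivity) h hp.le
  rw [Real.div_rpow hu hp.le, ← Real.exp_mul, div_mul_cancel₀ _ hp.ne',
    div_le_iff₀ (by positivity)] at h2
  linarith

/-- The integrand defining `besselKer`, as a function of `s = ‖x‖ ^ 2` and `t`. -/
noncomputable def besselIntegrand (d : ℕ) (a s t : ℝ) : ℝ :=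
  (4 * Real.pi * t) ^ (-(d : ℝ) / 2) * Real.exp (-s / (4 * t)) *
    Real.exp (-t) * t ^ (a / 2 - 1)

lemma besselKer_eq (d : ℕ) (a : ℝ) (x : EuclideanSpace ℝ (Fin d)) :
    besselKer d a x = ∫ t in Ioi (0 : ℝ), besselIntegrand d a (‖x‖ ^ 2) t := rfl

lemma besselIntegrand_pos (d : ℕ) (a s : ℝ) {t : ℝ} (ht : 0 < t) :
    0 < besselIntegrand d a s t := by
  unfold besselIntegrand
  positivity

lemma besselIntegrand_anti (d : ℕ) (a : ℝ) {s s' t : ℝ} (ht : 0 < t) (hs : s ≤ s') :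
    besselIntegrand d a s' t ≤ besselIntegrand d a s t := by
  unfold besselIntegrand
  gcongr

lemma measurable_besselIntegrand (d : ℕ) (a s : ℝ) : Measurable (besselIntegrand d a s) := by
  unfold besselIntegrand
  fun_prop

lemma besselIntegrand_le (d : ℕ) (a : ℝ) {N s t : ℝ} (hN : 0 < N) (hs : 0 < s) (ht : 0 < t) :
    besselIntegrand d a s t ≤ ((4 * Real.pi) ^ (-(d : ℝ) / 2) * (4 * N) ^ N * s ^ (-N)) *
      (Real.exp (-t) * t ^ ((N - (d - a) / 2) - 1)) := by
  have h := rpow_le_rpow_mul_exp (u := s / (4 * t)) (by positivity) hN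
  have h1 : Real.exp (-s / (4 * t)) ≤ (4 * N) ^ N * s ^ (-N) * t ^ N := by
    rw [neg_div, Real.exp_neg, inv_le_iff_one_le_mul₀ (Real.exp_pos _)]
    rw [Real.div_rpow hs.le (by positivity), div_le_iff₀ (by positivity),
      Real.mul_rpow (by norm_num) ht.le] at h
    rw [Real.rpow_neg hs.le, Real.mul_rpow (by norm_num) hN.le]
    have : 0 < s ^ N := by positivity
    field_simp
    linarith
  have h2 : t ^ ((N - (d - a) / 2) - 1) = t ^ N * (t ^ (-(d : ℝ) / 2) * t ^ (a / 2 - 1)) := by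
    rw [← Real.rpow_add ht, ← Real.rpow_add ht]; ring_nf
  unfold besselIntegrand
  rw [h2, Real.mul_rpow (by positivity) ht.le]
  calc _ ≤ (4 * Real.pi) ^ (-(d : ℝ) / 2) * t ^ (-(d : ℝ) / 2) *
        ((4 * N) ^ N * s ^ (-N) * t ^ N) * Real.exp (-t) * t ^ (a / 2 - 1) := by gcongr
    _ = _ := by ring

lemma integrableOn_besselIntegrand (d : ℕ) (a : ℝ) {s : ℝ} (hs : 0 < s) :
    IntegrableOn (besselIntegrand d a s) (Ioi 0) := by
  obtain ⟨N, hN0, hN⟩ : ∃ N : ℝ, 0 < N ∧ (d - a) / 2 < N :=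
    ⟨|(d - a) / 2| + 1, by positivity, by linarith [le_abs_self ((d - a) / 2)]⟩
  refine Integrable.mono' ((Real.GammaIntegral_convergent (sub_pos.2 hN)).const_mul
    ((4 * Real.pi) ^ (-(d : ℝ) / 2) * (4 * N) ^ N * s ^ (-N)))
    (measurable_besselIntegrand d a s).aestronglyMeasurable ?_
  filter_upwards [ae_restrict_mem measurableSet_Ioi] with t ht
  rw [Real.norm_of_nonneg (besselIntegrand_pos d a s ht).le]
  exact besselIntegrand_le d a hN0 hs ht

lemma besselKer_nonneg (d : ℕ) (a : ℝ) (x : EuclideanSpace ℝ (Fin d)) : 0 ≤ besselKer d a x :=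
  setIntegral_nonneg measurableSet_Ioi fun _ ht => (besselIntegrand_pos d a _ ht).le

lemma exists_besselKer_le (d : ℕ) (a : ℝ) {N : ℝ} (hN0 : 0 < N) (hN : (d - a) / 2 < N) :
    ∃ C : ℝ, 0 ≤ C ∧ ∀ x : EuclideanSpace ℝ (Fin d), x ≠ 0 →
      besselKer d a x ≤ C * ‖x‖ ^ (-(2 * N)) := by
  have hG := Real.GammaIntegral_convergent (sub_pos.2 hN)
  refine ⟨(4 * Real.pi) ^ (-(d : ℝ) / 2) * (4 * N) ^ N *
    ∫ t in Ioi (0 : ℝ), Real.exp (-t) * t ^ ((N - (d - a) / 2) - 1), ?_, fun x hx => ?_⟩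
  · refine mul_nonneg (by positivity) (setIntegral_nonneg measurableSet_Ioi fun t ht => ?_)
    have : 0 < t := ht
    positivity
  · have hx' : 0 < ‖x‖ := norm_pos_iff.2 hx
    have h := setIntegral_mono_on (integrableOn_besselIntegrand d a (s := ‖x‖ ^ 2) (by positivity))
      (hG.const_mul _) measurableSet_Ioi
      fun t ht => besselIntegrand_le d a hN0 (s := ‖x‖ ^ 2) (by positivity) ht
    rw [integral_const_mul] at h
    have e : (‖x‖ ^ 2) ^ (-N) = ‖x‖ ^ (-(2 * N)) := by
      rw [← Real.rpow_natCast, ← Real.rpow_mul hx'.le]; norm_num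
    rw [e] at h
    rw [besselKer_eq]
    linarith

lemma exists_le_besselKer (d : ℕ) (a : ℝ) :
    ∃ c : ℝ, 0 < c ∧ ∀ x : EuclideanSpace ℝ (Fin d), x ≠ 0 → ‖x‖ ≤ 1 → c ≤ besselKer d a x := by
  refine ⟨∫ t in Ioi (0 : ℝ), besselIntegrand d a 1 t, ?_, fun x hx hx1 => ?_⟩
  · rw [setIntegral_pos_iff_support_of_nonneg_ae]
    · have : Ioi (0 : ℝ) ⊆ Function.support (besselIntegrand d a 1) :=
        fun t ht => (besselIntegrand_pos d a 1 ht).ne'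
      rw [inter_eq_self_of_subset_right this]
      simp
    · filter_upwards [ae_restrict_mem measurableSet_Ioi] with t ht
      exact (besselIntegrand_pos d a 1 ht).le
    · exact integrableOn_besselIntegrand d a one_pos
  · have hx' : 0 < ‖x‖ := norm_pos_iff.2 hx
    exact setIntegral_mono_on (integrableOn_besselIntegrand d a one_pos)
      (integrableOn_besselIntegrand d a (by positivity)) measurableSet_Ioi
      fun t ht => besselIntegrand_anti d a ht (pow_le_one₀ hx'.le hx1)

/-- A radial function with power singularity `p < d` at `0` and power decay `q > d` at infinity has
finite integral. -/
lemma lintegral_ite_norm_rpow_lt_top {d : ℕ} (hd : 1 ≤ d) {p q : ℝ} (hp : p < d) (hq : d < q) :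
    (∫⁻ x : EuclideanSpace ℝ (Fin d),
      ENNReal.ofReal (if ‖x‖ ≤ 1 then ‖x‖ ^ (-p) else ‖x‖ ^ (-q))) < ⊤ := by
  have : Nonempty (Fin d) := ⟨⟨0, hd⟩⟩
  have hcast : (((d - 1 : ℕ) : ℝ)) = d - 1 := by push_cast [Nat.cast_sub hd]; ring
  refine Integrable.lintegral_lt_top ?_
  refine (integrable_fun_norm_addHaar (E := EuclideanSpace ℝ (Fin d)) volume
    (f := fun s : ℝ => if s ≤ 1 then s ^ (-p) else s ^ (-q))).2 ?_
  rw [finrank_euclideanSpace, Fintype.card_fin, ← Ioc_union_Ioi_eq_Ioi zero_le_one]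
  refine IntegrableOn.union ?_ ?_
  · have h := (intervalIntegrable_iff_integrableOn_Ioc_of_le zero_le_one).1
      (intervalIntegral.intervalIntegrable_rpow' (a := 0) (b := 1) (r := (d - 1 : ℝ) - p)
        (by linarith))
    refine h.congr_fun (fun s hs => ?_) measurableSet_Ioc
    simp only [if_pos hs.2, smul_eq_mul]
    rw [← Real.rpow_natCast, ← Real.rpow_add hs.1, hcast, sub_eq_add_neg]
  · refine (integrableOn_Ioi_rpow_of_lt (a := (d - 1 : ℝ) - q) (by linarith) one_pos).congr_fun
      (fun s hs => ?_) measurableSet_Ioi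
    have hs' : 0 < s := one_pos.trans hs
    simp only [if_neg (not_le.2 (mem_Ioi.1 hs)), smul_eq_mul]
    rw [← Real.rpow_natCast, ← Real.rpow_add hs', hcast, sub_eq_add_neg]

/-- An integrable radial majorant of `besselKer d a x ^ r`. -/
lemma exists_besselKer_rpow_majorant {d : ℕ} (hd : 1 ≤ d) {a r : ℝ} (had : a < d) (hr : 1 ≤ r)
    (hrd : r < (d : ℝ) / (d - a)) :
    ∃ F : EuclideanSpace ℝ (Fin d) → ℝ, Measurable F ∧ (∀ x, 0 ≤ F x) ∧
      (∀ x, x ≠ 0 → besselKer d a x ^ r ≤ F x) ∧ (∫⁻ x, ENNReal.ofReal (F x)) < ⊤ := by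
  have hda : 0 < (d : ℝ) - a := sub_pos.2 had
  have hr0 : 0 < r := one_pos.trans_le hr
  have hd' : (1 : ℝ) ≤ d := by exact_mod_cast hd
  rw [lt_div_iff₀ hda] at hrd
  obtain ⟨P, hP1, hP2⟩ : ∃ P, (d : ℝ) - a < P ∧ P < d / r :=
    exists_between (by rw [lt_div_iff₀ hr0]; linarith)
  rw [lt_div_iff₀ hr0] at hP2
  set Q : ℝ := (d - a) + d + 1 with hQ
  have key : ∀ P : ℝ, d - a < P → ∃ C : ℝ, 0 ≤ C ∧ ∀ x : EuclideanSpace ℝ (Fin d), x ≠ 0 →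
      besselKer d a x ^ r ≤ C * ‖x‖ ^ (-(P * r)) := by
    intro P hP
    obtain ⟨C, hC, h⟩ := exists_besselKer_le d a (N := P / 2) (by linarith) (by linarith)
    refine ⟨C ^ r, by positivity, fun x hx => ?_⟩
    refine (Real.rpow_le_rpow (besselKer_nonneg d a x) (h x hx) hr0.le).trans_eq ?_
    rw [Real.mul_rpow hC (by positivity), ← Real.rpow_mul (norm_nonneg x)]
    ring_nf
  obtain ⟨C₁, hC₁, h₁⟩ := key P hP1
  obtain ⟨C₂, hC₂, h₂⟩ := key Q (by linarith)
  refine ⟨fun x => (C₁ + C₂) * if ‖x‖ ≤ 1 then ‖x‖ ^ (-(P * r)) else ‖x‖ ^ (-(Q * r)),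
    ?_, fun x => ?_, fun x hx => ?_, ?_⟩
  · exact (Measurable.ite (measurableSet_le measurable_norm measurable_const)
      (by fun_prop) (by fun_prop)).const_mul _
  · dsimp only
    split_ifs <;> positivity
  · dsimp only
    split_ifs
    · refine (h₁ x hx).trans ?_
      gcongr; linarith
    · refine (h₂ x hx).trans ?_
      gcongr; linarith
  · simp_rw [ENNReal.ofReal_mul (add_nonneg hC₁ hC₂)]
    rw [lintegral_const_mul' _ _ ENNReal.ofReal_ne_top]
    exact ENNReal.mul_lt_top ENNReal.ofReal_lt_top
      (lintegral_ite_norm_rpow_lt_top hd hP2 (by nlinarith))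

/-- Rapid decay of `besselKer`, phrased through any point `x` of norm at most `2 * ‖v‖`. -/
lemma exists_besselKer_rpow_le_weight {d : ℕ} {a r k : ℝ} (hr : 1 ≤ r) (hk : 0 ≤ k) :
    ∃ C : ℝ, 0 ≤ C ∧ ∀ x v : EuclideanSpace ℝ (Fin d), 1 ≤ ‖v‖ → ‖x‖ ≤ 2 * ‖v‖ →
      besselKer d a v ^ r ≤ C * (1 + ‖x‖ ^ 2) ^ (-k / 2) := by
  set N : ℝ := |(d - a) / 2| + 1 + k / 2 with hN
  have hN0 : 0 < N := by positivity
  obtain ⟨C, hC, h⟩ := exists_besselKer_le d a hN0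
    (by linarith [le_abs_self ((d - a) / 2)])
  have hr0 : 0 < r := one_pos.trans_le hr
  refine ⟨C ^ r * 5 ^ (k / 2), by positivity, fun x v hv hxv => ?_⟩
  have hv0 : 0 < ‖v‖ := one_pos.trans_le hv
  have h5 : (5 * ‖v‖ ^ 2) ^ (-k / 2) ≤ (1 + ‖x‖ ^ 2) ^ (-k / 2) :=
    Real.rpow_le_rpow_of_nonpos (by positivity) (by nlinarith [norm_nonneg x]) (by linarith)
  have e5 : ‖v‖ ^ (-k) = 5 ^ (k / 2) * (5 * ‖v‖ ^ 2) ^ (-k / 2) := by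
    rw [Real.mul_rpow (by norm_num) (by positivity), ← mul_assoc, ← Real.rpow_add (by norm_num),
      ← Real.rpow_natCast, ← Real.rpow_mul hv0.le]
    norm_num
    ring_nf
    norm_num
  calc besselKer d a v ^ r ≤ (C * ‖v‖ ^ (-(2 * N))) ^ r :=
        Real.rpow_le_rpow (besselKer_nonneg d a v) (h v (norm_pos_iff.1 hv0)) hr0.le
    _ = C ^ r * ‖v‖ ^ (-(2 * N) * r) := by
        rw [Real.mul_rpow hC (by positivity), ← Real.rpow_mul hv0.le]
    _ ≤ C ^ r * ‖v‖ ^ (-k) := by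
        refine mul_le_mul_of_nonneg_left (Real.rpow_le_rpow_of_exponent_le hv ?_) (by positivity)
        nlinarith [abs_nonneg ((d - a) / 2)]
    _ ≤ C ^ r * (5 ^ (k / 2) * (1 + ‖x‖ ^ 2) ^ (-k / 2)) := by rw [e5]; gcongr
    _ = _ := by ring

/-- Up to a tempered error, the convolution with the smaller exponent is controlled by the one with
the larger exponent. -/
lemma exists_besselConv_le {d : ℕ} (hd : 1 ≤ d) {a r₁ r₂ k : ℝ} (had : a < d) (hr₁ : 1 ≤ r₁)
    (hr₁₂ : r₁ ≤ r₂) (hr₁d : r₁ < (d : ℝ) / (d - a)) (hk : 0 ≤ k) :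
    ∃ A B : ℝ≥0∞, A ≠ ⊤ ∧ B ≠ ⊤ ∧ ∀ x : EuclideanSpace ℝ (Fin d),
      besselConv d a r₁ x ≤
        A * besselConv d a r₂ x + B * ENNReal.ofReal ((1 + ‖x‖ ^ 2) ^ (-k / 2)) := by
  have : Nonempty (Fin d) := ⟨⟨0, hd⟩⟩
  obtain ⟨c, hc, hcG⟩ := exists_le_besselKer d a
  obtain ⟨F, hFm, hF0, hGF, hFi⟩ := exists_besselKer_rpow_majorant hd had hr₁ hr₁d
  obtain ⟨C, hC, hCG⟩ := exists_besselKer_rpow_le_weight (d := d) (a := a) hr₁ hk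
  set M : ℝ := c ^ (r₁ - r₂) with hM
  have hM0 : 0 ≤ M := by positivity
  have hloc : ∀ z : EuclideanSpace ℝ (Fin d), z ≠ 0 → ‖z‖ ≤ 1 →
      besselKer d a z ^ r₁ ≤ M * besselKer d a z ^ r₂ := by
    intro z hz hz1
    have h := hcG z hz hz1
    have hG : 0 < besselKer d a z := hc.trans_le h
    calc besselKer d a z ^ r₁ = besselKer d a z ^ (r₁ - r₂) * besselKer d a z ^ r₂ := by
          rw [← Real.rpow_add hG]; ring_nf
      _ ≤ _ := by
          gcongr
          exact Real.rpow_le_rpow_of_nonpos hc h (by linarith)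
  have hpos : ∀ (z : EuclideanSpace ℝ (Fin d)) (r : ℝ), 0 ≤ besselKer d a z ^ r :=
    fun z r => Real.rpow_nonneg (besselKer_nonneg d a z) r
  have hpt : ∀ x y : EuclideanSpace ℝ (Fin d), y ≠ 0 → y ≠ x →
      besselKer d a (x - y) ^ r₁ * besselKer d a y ^ r₁ ≤
        M ^ 2 * (besselKer d a (x - y) ^ r₂ * besselKer d a y ^ r₂) +
          C * (1 + ‖x‖ ^ 2) ^ (-k / 2) * (F (x - y) + F y) := by
    intro x y hy hyx
    have hxy : x - y ≠ 0 := sub_ne_zero.2 hyx.symm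
    have htri : ‖x‖ ≤ ‖x - y‖ + ‖y‖ := by simpa using norm_add_le (x - y) y
    have hw : 0 ≤ C * (1 + ‖x‖ ^ 2) ^ (-k / 2) := by positivity
    have hfirst := mul_nonneg (pow_nonneg hM0 2) (mul_nonneg (hpos (x - y) r₂) (hpos y r₂))
    have hsx := mul_nonneg hw (hF0 (x - y))
    have hsy := mul_nonneg hw (hF0 y)
    rcases le_total ‖x - y‖ ‖y‖ with h | h
    · rcases le_total ‖y‖ 1 with h1 | h1
      · have := mul_le_mul (hloc _ hxy (h.trans h1)) (hloc _ hy h1) (hpos _ _)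
          (mul_nonneg hM0 (hpos _ _))
        nlinarith
      · have := mul_le_mul (hGF _ hxy) (hCG x y h1 (by linarith)) (hpos _ _) (hF0 _)
        nlinarith
    · rcases le_total ‖x - y‖ 1 with h1 | h1
      · have := mul_le_mul (hloc _ hxy h1) (hloc _ hy (h.trans h1)) (hpos _ _)
          (mul_nonneg hM0 (hpos _ _))
        nlinarith
      · have := mul_le_mul (hCG x (x - y) h1 (by linarith)) (hGF _ hy) (hpos _ _) hw
        nlinarith
  set I : ℝ≥0∞ := ∫⁻ x, ENNReal.ofReal (F x) with hI
  refine ⟨ENNReal.ofReal (M ^ 2), ENNReal.ofReal C * (I + I), ENNReal.ofReal_ne_top,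
    ENNReal.mul_ne_top ENNReal.ofReal_ne_top (ENNReal.add_ne_top.2 ⟨hFi.ne, hFi.ne⟩),
    fun x => ?_⟩
  set w : ℝ := (1 + ‖x‖ ^ 2) ^ (-k / 2) with hwdef
  have hw0 : 0 ≤ w := by positivity
  calc besselConv d a r₁ x
      ≤ ∫⁻ y, (ENNReal.ofReal (M ^ 2) *
            ENNReal.ofReal (besselKer d a (x - y) ^ r₂ * besselKer d a y ^ r₂) +
          ENNReal.ofReal (C * w) * (ENNReal.ofReal (F (x - y)) + ENNReal.ofReal (F y))) := by
        refine lintegral_mono_ae ?_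
        filter_upwards [Measure.ae_ne volume (0 : EuclideanSpace ℝ (Fin d)),
          Measure.ae_ne volume x] with y hy hyx
        rw [← ENNReal.ofReal_add (hF0 _) (hF0 _), ← ENNReal.ofReal_mul (by positivity),
          ← ENNReal.ofReal_mul (by positivity), ← ENNReal.ofReal_add
            (mul_nonneg (by positivity) (mul_nonneg (hpos _ _) (hpos _ _)))
            (mul_nonneg (by positivity) (add_nonneg (hF0 _) (hF0 _)))]
        exact ENNReal.ofReal_le_ofReal (hpt x y hy hyx)
    _ = ENNReal.ofReal (M ^ 2) * besselConv d a r₂ x + ENNReal.ofReal (C * w) * (I + I) := by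
        rw [lintegral_add_right _ (by fun_prop), lintegral_const_mul' _ _ ENNReal.ofReal_ne_top,
          lintegral_const_mul' _ _ ENNReal.ofReal_ne_top, lintegral_add_right _ (by fun_prop),
          lintegral_sub_left_eq_self (fun y => ENNReal.ofReal (F y)) x]
        rfl
    _ = _ := by rw [ENNReal.ofReal_mul hC]; ring

/-- **Monotonicity of the strongly reinforced Dalang condition in the integrability
parameter.** -/
theorem dalang_condition_monotone (d : ℕ) (hd : 1 ≤ d) (a : ℝ) (ha0 : 0 < a) (had : a < d)
    (r₁ r₂ : ℝ) (hr₁ : 1 ≤ r₁) (hr₁₂ : r₁ ≤ r₂) (hr₂ : r₂ < (d : ℝ) / ((d : ℝ) - a))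
    (μ : Measure (EuclideanSpace ℝ (Fin d)))
    (htemp : ∃ k : ℝ, 0 ≤ k ∧
      (∫⁻ x, ENNReal.ofReal ((1 + ‖x‖ ^ 2) ^ (-k / 2)) ∂μ) < ⊤)
    (hfin : (∫⁻ x, besselConv d a r₂ x ∂μ) < ⊤) :
    (∫⁻ x, besselConv d a r₁ x ∂μ) < ⊤ := by
  obtain ⟨k, hk, hki⟩ := htemp
  obtain ⟨A, B, hA, hB, h⟩ := exists_besselConv_le hd had hr₁ hr₁₂ (hr₁₂.trans_lt hr₂) hk
  refine (lintegral_mono h).trans_lt ?_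
  rw [lintegral_add_right _ (by fun_prop), lintegral_const_mul' _ _ hA,
    lintegral_const_mul' _ _ hB]
  exact ENNReal.add_lt_top.2 ⟨ENNReal.mul_lt_top hA.lt_top hfin,
    ENNReal.mul_lt_top hB.lt_top hki⟩
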